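/- Let I be a finite poset satisfying condition (F) and having no source, let (λ_i)_{i∈I} be real numbers with λ_i > n_{i·}/2 for all i, and let W ∈ 𝒯_l⁺. Let θ ∈ ℋ be defined by θ_{jk} = (Wᵀ·W)_{jk} when j = k or j, k are comparable, and θ_{jk} = 0 otherwise. Then ∫_𝒫 (∏_{i∈I} X_{[i]·}^{λ_i−n_i}) exp(−tr(θ·X)) dX = π^{(n_{··}−|I|)/2} (∏_{i∈I} Γ(λ_i − n_{i·}/2)) (∏_{i∈I} (W_{ii})^{−2λ_i}), where dX is Lebesgue measure on ℋ in the coordinates (X_{ii})_{i∈I} and (X_{ij})_{j≺i}. -/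

import Mathlib

open Matrix MeasureTheory ProbabilityTheory
open scoped Classical

variable (I : Type*) [Fintype I] [DecidableEq I] [PartialOrder I]

/-- `𝒯_l` : matrices that are lower triangular with respect to the poset `I`. -/
def IsTl (A : Matrix I I ℝ) : Prop :=
  ∀ j k, ¬ k ≤ j → A j k = 0

/-- `𝒯_l⁺` : lower triangular matrices with strictly positive diagonal entries. -/
def IsTlPos (A : Matrix I I ℝ) : Prop :=
  IsTl I A ∧ ∀ i, 0 < A i i

/-- The homogeneous cone `𝒫 = {T·Tᵀ : T ∈ 𝒯_l⁺}`. -/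
def Pset : Set (Matrix I I ℝ) :=
  {S | ∃ T : Matrix I I ℝ, IsTlPos I T ∧ S = T * Tᵀ}

/-- `ℋ` : symmetric matrices vanishing at incomparable pairs of indices. -/
def Hset : Set (Matrix I I ℝ) :=
  {X | X.IsSymm ∧ ∀ i j : I, ¬ (i ≤ j ∨ j ≤ i) → X i j = 0}

/-- A source of a poset. -/
def HasSource : Prop :=
  ∃ k i j : I, ¬ i ≤ j ∧ ¬ j ≤ i ∧ k < i ∧ k < j

/-- Condition (F). -/
def ConditionF : Prop :=
  ∀ i j : I, (i < j ∨ j < i) → ∀ p q : (SimpleGraph.hasse I).Path i j, p = q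

variable {I}

/-- Cholesky factor (junk value `1` outside `𝒫`). -/
noncomputable def chol (S : Matrix I I ℝ) : Matrix I I ℝ :=
  if h : ∃ T : Matrix I I ℝ, IsTlPos I T ∧ S = T * Tᵀ then h.choose else 1

/-- `S_{[i]·} = (T_{ii})²` where `S = T·Tᵀ`, `T ∈ 𝒯_l⁺`. -/
noncomputable def bracket (S : Matrix I I ℝ) (i : I) : ℝ := (chol S i i) ^ 2

/-- `n_{i·}` : number of elements strictly below `i`. -/
noncomputable def nlow (i : I) : ℕ := (Finset.univ.filter fun j : I => j < i).card

/-- `n_{·i}` : number of elements strictly above `i`. -/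
noncomputable def nup (i : I) : ℕ := (Finset.univ.filter fun j : I => i < j).card

/-- `n_i = 1 + (n_{i·} + n_{·i})/2`. -/
noncomputable def nmid (i : I) : ℝ := 1 + ((nlow i : ℝ) + (nup i : ℝ)) / 2

variable (I)

/-- `n_{··} = Σ_i n_i`. -/
noncomputable def ntot : ℝ := ∑ i : I, nmid i

/-- The coordinate space of `ℋ` : the diagonal entries and the entries `X_{ij}`, `j ≺ i`. -/
abbrev Coords := (I → ℝ) × ({p : I × I // p.2 < p.1} → ℝ)

/-- The symmetric matrix with given coordinates. -/
noncomputable def toMat (x : Coords I) : Matrix I I ℝ :=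
  fun j k =>
    if _ : j = k then x.1 j
    else if h : k < j then x.2 ⟨(j, k), h⟩
    else if h' : j < k then x.2 ⟨(k, j), h'⟩
    else 0

variable {I}

/-- `σ^{-χ} = (Zᵀ)⁻¹ · diag(λ) · Z⁻¹` where `σ = Z·Zᵀ`, `Z ∈ 𝒯_l⁺`. -/
noncomputable def sigmaNegChi (lam : I → ℝ) (σ : Matrix I I ℝ) : Matrix I I ℝ :=
  ((chol σ)ᵀ)⁻¹ * Matrix.diagonal lam * (chol σ)⁻¹

/-- The density of the Wishart distribution `HW_{χ,σ}` with respect to Lebesgue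
measure on `ℋ`. -/
noncomputable def wishartDensity (lam : I → ℝ) (σ : Matrix I I ℝ)
    (X : Matrix I I ℝ) : ℝ :=
  if X ∈ Pset I then
    Real.pi ^ (((Fintype.card I : ℝ) - ntot I) / 2) * (∏ i : I, lam i ^ lam i) *
      (∏ i : I, bracket X i ^ (lam i - nmid i)) *
      Real.exp (-(sigmaNegChi lam σ * X).trace) /
      ((∏ i : I, Real.Gamma (lam i - (nlow i : ℝ) / 2)) *
        ∏ i : I, bracket σ i ^ lam i)
  else 0

/-- The σ-algebra on the space of matrices, coming from its identification with a
product of copies of `ℝ`. -/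
instance Matrix.measurableSpace {m n : Type*} : MeasurableSpace (Matrix m n ℝ) :=
  show MeasurableSpace (m → n → ℝ) from inferInstance

/-- The Wishart distribution `HW_{χ,σ}` on the homogeneous cone `𝒫`, as a measure
on the space of matrices: the image under the coordinate parametrization of `ℋ`
of the measure with the Wishart density with respect to Lebesgue measure. -/
noncomputable def HW (lam : I → ℝ) (σ : Matrix I I ℝ) : Measure (Matrix I I ℝ) :=
  Measure.map (toMat I)
    (volume.withDensity fun x => ENNReal.ofReal (wishartDensity lam σ (toMat I x)))

/-- `e^χ = diag(λ)`. -/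
noncomputable def eChi (lam : I → ℝ) : Matrix I I ℝ := Matrix.diagonal lam

namespace PosetCholesky

set_option linter.unusedSectionVars false

/-! ### Coordinates of triangular matrices -/

variable (I) in
/-- The pairs `(i, j)` with `j ≺ i`. -/
abbrev StrictPair := {p : I × I // p.2 < p.1}

variable (I) in
/-- Index set of the coordinates: diagonal positions and strictly lower positions. -/
abbrev Idx := I ⊕ StrictPair I

/-- Row of a position. -/
def row : Idx I → I := Sum.elim id fun p => p.1.1

/-- Column of a position. -/
def col : Idx I → I := Sum.elim id fun p => p.1.2

@[simp] lemma row_inl (i : I) : row (Sum.inl i : Idx I) = i := rfl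
@[simp] lemma col_inl (i : I) : col (Sum.inl i : Idx I) = i := rfl
@[simp] lemma row_inr (p : StrictPair I) : row (Sum.inr p : Idx I) = p.1.1 := rfl
@[simp] lemma col_inr (p : StrictPair I) : col (Sum.inr p : Idx I) = p.1.2 := rfl

lemma col_le_row (p : Idx I) : col p ≤ row p := by
  rcases p with i | p
  · exact le_rfl
  · exact p.2.le

lemma idx_ext {p q : Idx I} (hr : row p = row q) (hc : col p = col q) : p = q := by
  rcases p with i | ⟨⟨a, b⟩, h⟩ <;> rcases q with j | ⟨⟨c, d⟩, h'⟩
  · simpa using hr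
  · simp only [row_inl, row_inr, col_inl, col_inr] at hr hc
    subst hr hc
    exact absurd h' (lt_irrefl _)
  · simp only [row_inl, row_inr, col_inl, col_inr] at hr hc
    subst hr hc
    exact absurd h (lt_irrefl _)
  · simp only [row_inr, col_inr] at hr hc
    subst hr hc
    rfl

lemma exists_idx {j k : I} (h : k ≤ j) : ∃ p : Idx I, row p = j ∧ col p = k := by
  rcases h.eq_or_lt with rfl | h
  · exact ⟨Sum.inl k, rfl, rfl⟩
  · exact ⟨Sum.inr ⟨(j, k), h⟩, rfl, rfl⟩

/-- The `(j, k)` entry of the lower triangular matrix with given coordinates. -/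
noncomputable def entry (j k : I) : (Idx I → ℝ) →L[ℝ] ℝ :=
  if j = k then ContinuousLinearMap.proj (Sum.inl j)
  else if h : k < j then ContinuousLinearMap.proj (Sum.inr ⟨(j, k), h⟩)
  else 0

/-- The lower triangular matrix with given coordinates. -/
noncomputable def tri (t : Idx I → ℝ) : Matrix I I ℝ := fun j k => entry j k t

lemma entry_row_col (p : Idx I) : entry (row p) (col p) = ContinuousLinearMap.proj p := by
  rcases p with i | ⟨⟨a, b⟩, h⟩
  · simp [entry]
  · have h' : b < a := h
    simp [entry, h', h'.ne']

@[simp] lemma tri_row_col (t : Idx I → ℝ) (p : Idx I) : tri t (row p) (col p) = t p := by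
  simp [tri, entry_row_col]

@[simp] lemma tri_diag (t : Idx I → ℝ) (i : I) : tri t i i = t (Sum.inl i) :=
  tri_row_col t (Sum.inl i)

lemma entry_eq_zero {j k : I} (h : ¬ k ≤ j) : entry j k = 0 := by
  have h1 : j ≠ k := fun e => h e.ge
  have h2 : ¬ k < j := fun e => h e.le
  simp [entry, h1, h2]

lemma isTl_tri (t : Idx I → ℝ) : IsTl I (tri t) := fun j k h => by
  simp [tri, entry_eq_zero h]

lemma isTl_ext {A B : Matrix I I ℝ} (hA : IsTl I A) (hB : IsTl I B)
    (h : ∀ p : Idx I, A (row p) (col p) = B (row p) (col p)) : A = B := by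
  ext j k
  by_cases hjk : k ≤ j
  · obtain ⟨p, rfl, rfl⟩ := exists_idx hjk
    exact h p
  · rw [hA j k hjk, hB j k hjk]

lemma tri_coord {A : Matrix I I ℝ} (hA : IsTl I A) :
    tri (fun p : Idx I => A (row p) (col p)) = A :=
  isTl_ext (isTl_tri _) hA fun p => tri_row_col _ p

lemma entry_single (j k : I) (q : Idx I) :
    entry j k (Pi.single q 1) = if row q = j ∧ col q = k then 1 else 0 := by
  by_cases hjk : k ≤ j
  · obtain ⟨p, rfl, rfl⟩ := exists_idx hjk
    rw [entry_row_col, ContinuousLinearMap.proj_apply, Pi.single_apply]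
    refine if_congr ⟨fun h => by simp [h], fun h => (idx_ext h.1 h.2).symm⟩ rfl rfl
  · rw [entry_eq_zero hjk, if_neg]
    · rfl
    · rintro ⟨rfl, rfl⟩
      exact hjk (col_le_row q)

lemma isTl_mul {A B : Matrix I I ℝ} (hA : IsTl I A) (hB : IsTl I B) : IsTl I (A * B) := by
  intro j k h
  rw [Matrix.mul_apply]
  refine Finset.sum_eq_zero fun m _ => ?_
  by_cases hm : m ≤ j
  · rw [hB m k fun h' => h (h'.trans hm), mul_zero]
  · rw [hA j m hm, zero_mul]

lemma isTl_sum_sq {A : Matrix I I ℝ} (hA : IsTl I A) :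
    ∑ j, ∑ k, A j k ^ 2 = ∑ p : Idx I, A (row p) (col p) ^ 2 := by
  rw [← Fintype.sum_prod_type' (f := fun j k => A j k ^ 2)]
  symm
  refine Finset.sum_of_injOn (fun p => (row p, col p)) ?_ (by simp) ?_ (by simp)
  · intro p _ q _ h
    exact idx_ext (congrArg Prod.fst h) (congrArg Prod.snd h)
  · rintro ⟨j, k⟩ _ h
    by_cases hjk : k ≤ j
    · obtain ⟨p, rfl, rfl⟩ := exists_idx hjk
      exact absurd ⟨p, by simp⟩ h
    · simp [hA j k hjk]

/-! ### Uniqueness of the Cholesky factor -/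

lemma eq_of_mul_transpose_eq {A B : Matrix I I ℝ} (hA : IsTlPos I A) (hB : IsTlPos I B)
    (h : A * Aᵀ = B * Bᵀ) : A = B := by
  suffices H : ∀ k j, A j k = B j k from Matrix.ext fun j k => H k j
  intro k
  induction k using (wellFounded_lt (α := I)).induction with
  | _ k ih =>
  have key : ∀ j, A j k * A k k = B j k * B k k := by
    intro j
    have hj := congrFun (congrFun h j) k
    simp only [Matrix.mul_apply, Matrix.transpose_apply] at hj
    rw [← Finset.add_sum_erase _ _ (Finset.mem_univ k),
      ← Finset.add_sum_erase _ (fun m => B j m * B k m) (Finset.mem_univ k)] at hj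
    have hs : ∑ m ∈ Finset.univ.erase k, A j m * A k m =
        ∑ m ∈ Finset.univ.erase k, B j m * B k m := by
      refine Finset.sum_congr rfl fun m hm => ?_
      by_cases hmk : m ≤ k
      · have hlt : m < k := lt_of_le_of_ne hmk (Finset.ne_of_mem_erase hm)
        rw [ih m hlt j, ih m hlt k]
      · rw [hA.1 k m hmk, hB.1 k m hmk, mul_zero, mul_zero]
    linarith
  have hk : A k k = B k k :=
    (mul_self_inj (hA.2 k).le (hB.2 k).le).1 (key k)
  intro j
  have := key j
  rw [hk] at this
  exact mul_right_cancel₀ (hB.2 k).ne' this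

lemma bracket_mul_transpose {T : Matrix I I ℝ} (hT : IsTlPos I T) (i : I) :
    bracket (T * Tᵀ) i = T i i ^ 2 := by
  have h : ∃ T' : Matrix I I ℝ, IsTlPos I T' ∧ T * Tᵀ = T' * T'ᵀ := ⟨T, hT, rfl⟩
  rw [bracket, chol, dif_pos h,
    eq_of_mul_transpose_eq h.choose_spec.1 hT h.choose_spec.2.symm]

/-! ### Symmetric matrices supported on comparable pairs -/

/-- The coordinates of a matrix, as a single vector. -/
noncomputable def coord (A : Matrix I I ℝ) : Idx I → ℝ := fun p => A (row p) (col p)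

/-- A single vector of coordinates split into its diagonal and off-diagonal parts. -/
abbrev split (x : Idx I → ℝ) : Coords I :=
  MeasurableEquiv.sumPiEquivProdPi (fun _ : Idx I => ℝ) x

lemma coord_toMat_split (x : Idx I → ℝ) : coord (toMat I (split x)) = x := by
  funext p
  rcases p with i | ⟨⟨a, b⟩, h⟩
  · simp [coord, toMat, split, MeasurableEquiv.sumPiEquivProdPi]
  · have h' : b < a := h
    simp [coord, toMat, split, MeasurableEquiv.sumPiEquivProdPi, h', h'.ne']

lemma toMat_split_coord {A : Matrix I I ℝ} (hA : A ∈ Hset I) :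
    toMat I (split (coord A)) = A := by
  ext j k
  by_cases h : j = k
  · subst h
    simp [coord, toMat, split, MeasurableEquiv.sumPiEquivProdPi]
  by_cases h1 : k < j
  · simp [coord, toMat, split, MeasurableEquiv.sumPiEquivProdPi, h, h1]
  by_cases h2 : j < k
  · simp [coord, toMat, split, MeasurableEquiv.sumPiEquivProdPi, h, h1, h2, hA.1.apply]
  · rw [hA.2 j k fun h' => h'.elim (fun e => h2 (lt_of_le_of_ne e h))
      fun e => h1 (lt_of_le_of_ne e (Ne.symm h))]
    simp [toMat, h, h1, h2]

lemma mul_transpose_mem_Hset (hs : ¬ HasSource I) {T : Matrix I I ℝ} (hT : IsTl I T) :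
    T * Tᵀ ∈ Hset I := by
  refine ⟨Matrix.isSymm_mul_transpose_self T, fun i j hij => ?_⟩
  rw [Matrix.mul_apply]
  refine Finset.sum_eq_zero fun m _ => ?_
  rw [Matrix.transpose_apply]
  push Not at hij
  by_cases hi : m ≤ i
  · by_cases hj : m ≤ j
    · refine absurd ⟨m, i, j, hij.1, hij.2, lt_of_le_of_ne hi ?_, lt_of_le_of_ne hj ?_⟩ hs
      · rintro rfl
        exact hij.1 hj
      · rintro rfl
        exact hij.2 hi
    · rw [hT j m hj, mul_zero]
  · rw [hT i m hi, zero_mul]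

lemma trace_truncation_mul {A B X : Matrix I I ℝ} (hX : X ∈ Hset I)
    (hA : ∀ j k : I, A j k = if j = k ∨ j ≤ k ∨ k ≤ j then B j k else 0) :
    (A * X).trace = (B * X).trace := by
  simp only [Matrix.trace, Matrix.diag, Matrix.mul_apply]
  refine Finset.sum_congr rfl fun j _ => Finset.sum_congr rfl fun k _ => ?_
  rw [hA]
  split_ifs with h
  · rfl
  · rw [hX.2 k j fun h' => h (Or.inr h'.symm), mul_zero, mul_zero]

lemma trace_gram_mul_gram {W T : Matrix I I ℝ} (hW : IsTl I W) (hT : IsTl I T) :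
    (Wᵀ * W * (T * Tᵀ)).trace = ∑ p : Idx I, (W * T) (row p) (col p) ^ 2 := by
  have h : Wᵀ * W * (T * Tᵀ) = Wᵀ * (W * T * Tᵀ) := by simp only [Matrix.mul_assoc]
  rw [h, Matrix.trace_mul_comm, Matrix.mul_assoc, ← Matrix.transpose_mul]
  refine Eq.trans ?_ (isTl_sum_sq (isTl_mul hW hT))
  simp only [Matrix.trace, Matrix.diag, Matrix.mul_apply (M := W * T), Matrix.transpose_apply, sq]

/-! ### Jacobians of triangular maps -/

lemma det_of_triangular (M : Matrix (Idx I) (Idx I) ℝ)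
    (h : ∀ p q, M p q ≠ 0 → col q < col p ∨ (col q = col p ∧ row q ≤ row p)) :
    M.det = ∏ p, M p p := by
  let b : Idx I → LinearExtension I ×ₗ LinearExtension I := fun p =>
    toLex (toLinearExtension (col p), toLinearExtension (row p))
  have hb : Function.Injective b := fun p q hpq => by
    have h1 := congrArg (fun z => (ofLex z).1) hpq
    have h2 := congrArg (fun z => (ofLex z).2) hpq
    exact idx_ext h2 h1
  let _ : LinearOrder (Idx I) := LinearOrder.lift' b hb
  convert Matrix.det_of_isLowerTriangular M ?_
  intro p q hpq
  by_contra hne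
  have hlt : b p < b q := hpq
  refine not_le_of_gt hlt ?_
  rcases h p q hne with hc | ⟨hc, hr⟩
  · refine (Prod.Lex.le_iff).2 (Or.inl (lt_of_le_of_ne (toLinearExtension.monotone hc.le) ?_))
    exact fun e => hc.ne e
  · exact (Prod.Lex.le_iff).2
      (Or.inr ⟨congrArg toLinearExtension hc, toLinearExtension.monotone hr⟩)

lemma clm_det_eq (L : (Idx I → ℝ) →L[ℝ] (Idx I → ℝ)) :
    L.det = (Matrix.of fun p q : Idx I => L (Pi.single q 1) p).det := by
  rw [ContinuousLinearMap.det, ← LinearMap.det_toMatrix']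
  rfl

/-- The map taking a lower triangular matrix `T` to `W * T`, in coordinates. -/
noncomputable def mulLeft (W : Matrix I I ℝ) : (Idx I → ℝ) →L[ℝ] (Idx I → ℝ) :=
  ContinuousLinearMap.pi fun p => ∑ m, W (row p) m • entry m (col p)

lemma mulLeft_apply (W : Matrix I I ℝ) (t : Idx I → ℝ) (p : Idx I) :
    mulLeft W t p = (W * tri t) (row p) (col p) := by
  simp [mulLeft, Matrix.mul_apply, tri]

lemma mulLeft_diag {W : Matrix I I ℝ} (hW : IsTl I W) (t : Idx I → ℝ) (i : I) :
    mulLeft W t (Sum.inl i) = W i i * t (Sum.inl i) := by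
  rw [mulLeft_apply, row_inl, col_inl, Matrix.mul_apply, Finset.sum_eq_single i]
  · rw [tri_diag]
  · intro m _ hm
    by_cases h : m ≤ i
    · rw [isTl_tri t m i fun h' => hm (le_antisymm h h'), mul_zero]
    · rw [hW i m h, zero_mul]
  · simp

lemma det_mulLeft {W : Matrix I I ℝ} (hW : IsTl I W) :
    (mulLeft W).det = ∏ p : Idx I, W (row p) (row p) := by
  have key : ∀ p q : Idx I, mulLeft W (Pi.single q 1) p =
      if col q = col p then W (row p) (row q) else 0 := by
    intro p q
    simp [mulLeft, entry_single, ite_and]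
  rw [clm_det_eq, det_of_triangular]
  · simp [key]
  · intro p q h
    rw [Matrix.of_apply, key] at h
    split_ifs at h with hc
    · refine Or.inr ⟨hc, ?_⟩
      by_contra hr
      exact h (hW _ _ hr)
    · exact absurd rfl h

/-- The map `T ↦ T * Tᵀ`, in coordinates. -/
noncomputable def gram (t : Idx I → ℝ) : Idx I → ℝ := coord (tri t * (tri t)ᵀ)

/-- The derivative of `gram`. -/
noncomputable def gramDeriv (t : Idx I → ℝ) : (Idx I → ℝ) →L[ℝ] (Idx I → ℝ) :=
  ContinuousLinearMap.pi fun p => ∑ m,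
    (tri t (row p) m • entry (col p) m + tri t (col p) m • entry (row p) m)

lemma hasFDerivAt_gram (t : Idx I → ℝ) : HasFDerivAt gram (gramDeriv t) t := by
  rw [hasFDerivAt_pi']
  intro p
  have h : ∀ m : I, HasFDerivAt (fun s : Idx I → ℝ => entry (row p) m s * entry (col p) m s)
      (tri t (row p) m • entry (col p) m + tri t (col p) m • entry (row p) m) t := fun m =>
    (entry (row p) m).hasFDerivAt.mul (entry (col p) m).hasFDerivAt
  exact HasFDerivAt.fun_sum fun m _ => h m

lemma det_gramDeriv (t : Idx I → ℝ) :
    (gramDeriv t).det =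
      (∏ i : I, 2 * t (Sum.inl i)) * ∏ p : StrictPair I, t (Sum.inl p.1.2) := by
  have key : ∀ p q : Idx I, gramDeriv t (Pi.single q 1) p =
      (if row q = col p then tri t (row p) (col q) else 0) +
        if row q = row p then tri t (col p) (col q) else 0 := by
    intro p q
    simp [gramDeriv, entry_single, Finset.sum_add_distrib, ite_and]
  rw [clm_det_eq, det_of_triangular]
  · simp only [Matrix.of_apply, key, Fintype.prod_sum_type]
    congr 1
    · refine Finset.prod_congr rfl fun i _ => ?_
      simp [two_mul]
    · refine Finset.prod_congr rfl fun p _ => ?_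
      simp [p.2.ne']
  · intro p q h
    rw [Matrix.of_apply, key] at h
    by_contra hcon
    push Not at hcon
    apply h
    rw [ite_eq_right_iff.2, ite_eq_right_iff.2, add_zero]
    · intro hr
      refine isTl_tri t _ _ fun hc => ?_
      rcases hc.lt_or_eq with hc | hc
      · exact hcon.1 hc
      · exact hcon.2 hc hr.le
    · intro hr
      exfalso
      have hqp : col q ≤ col p := hr ▸ col_le_row q
      rcases hqp.lt_or_eq with hc | hc
      · exact hcon.1 hc
      · exact hcon.2 hc (hr ▸ col_le_row p)

/-! ### Counting strict pairs -/

@[to_additive]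
lemma prod_strictPair_snd {M : Type*} [CommMonoid M] (f : I → M) :
    ∏ p : StrictPair I, f p.1.2 = ∏ i, f i ^ nup i := by
  rw [← Fintype.prod_fiberwise (fun p : StrictPair I => p.1.2)]
  refine Finset.prod_congr rfl fun i _ => ?_
  rw [Finset.prod_congr rfl fun (p : {p : StrictPair I // p.1.2 = i}) _ => by rw [p.2],
    Finset.prod_const, nup]
  congr 1
  rw [Finset.card_univ, ← Fintype.card_subtype]
  exact Fintype.card_congr
    { toFun := fun p => ⟨p.1.1.1, by have := p.1.2; rw [p.2] at this; exact this⟩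
      invFun := fun j => ⟨⟨(j.1, i), j.2⟩, rfl⟩
      left_inv := by rintro ⟨⟨⟨a, b⟩, h⟩, rfl⟩; rfl
      right_inv := fun _ => rfl }

@[to_additive]
lemma prod_strictPair_fst {M : Type*} [CommMonoid M] (f : I → M) :
    ∏ p : StrictPair I, f p.1.1 = ∏ i, f i ^ nlow i := by
  rw [← Fintype.prod_fiberwise (fun p : StrictPair I => p.1.1)]
  refine Finset.prod_congr rfl fun i _ => ?_
  rw [Finset.prod_congr rfl fun (p : {p : StrictPair I // p.1.1 = i}) _ => by rw [p.2],
    Finset.prod_const, nlow]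
  congr 1
  rw [Finset.card_univ, ← Fintype.card_subtype]
  exact Fintype.card_congr
    { toFun := fun p => ⟨p.1.1.2, by have := p.1.2; rw [p.2] at this; exact this⟩
      invFun := fun j => ⟨⟨(i, j.1), j.2⟩, rfl⟩
      left_inv := by rintro ⟨⟨⟨a, b⟩, h⟩, rfl⟩; rfl
      right_inv := fun _ => rfl }

lemma card_strictPair : (Fintype.card (StrictPair I) : ℝ) = ntot I - Fintype.card I := by
  have h1 : (Fintype.card (StrictPair I) : ℝ) = ∑ i : I, (nlow i : ℝ) := by
    simpa using sum_strictPair_fst (I := I) fun _ => (1 : ℝ)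
  have h2 : (Fintype.card (StrictPair I) : ℝ) = ∑ i : I, (nup i : ℝ) := by
    simpa using sum_strictPair_snd (I := I) fun _ => (1 : ℝ)
  simp only [ntot, nmid, Finset.sum_add_distrib, ← Finset.sum_div, ← h1, ← h2]
  simp

/-! ### Change of variables -/

variable (I) in
/-- Coordinates of the lower triangular matrices with positive diagonal. -/
def posSet : Set (Idx I → ℝ) := {t | ∀ i, 0 < t (Sum.inl i)}

lemma measurableSet_posSet : MeasurableSet (posSet I) := by
  rw [posSet, Set.ofPred_forall]
  exact MeasurableSet.iInter fun i =>
    measurableSet_lt measurable_const (measurable_pi_apply _)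

lemma isTlPos_tri {t : Idx I → ℝ} (ht : t ∈ posSet I) : IsTlPos I (tri t) :=
  ⟨isTl_tri t, fun i => by rw [tri_diag]; exact ht i⟩

lemma toMat_split_gram (hs : ¬ HasSource I) (t : Idx I → ℝ) :
    toMat I (split (gram t)) = tri t * (tri t)ᵀ :=
  toMat_split_coord (mul_transpose_mem_Hset hs (isTl_tri t))

lemma injOn_gram (hs : ¬ HasSource I) : Set.InjOn gram (posSet I) := by
  intro t ht s hs' h
  have h1 : tri t = tri s := eq_of_mul_transpose_eq (isTlPos_tri ht) (isTlPos_tri hs') <| by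
    rw [← toMat_split_gram hs, ← toMat_split_gram hs, h]
  funext p
  rw [← tri_row_col t p, h1, tri_row_col]

lemma toMat_split_mem_Pset_iff (hs : ¬ HasSource I) (x : Idx I → ℝ) :
    toMat I (split x) ∈ Pset I ↔ x ∈ gram '' posSet I := by
  constructor
  · rintro ⟨T, hT, h⟩
    refine ⟨coord T, fun i => hT.2 i, ?_⟩
    rw [gram, show tri (coord T) = T from tri_coord hT.1, ← h, coord_toMat_split]
  · rintro ⟨t, ht, rfl⟩
    exact ⟨tri t, isTlPos_tri ht, toMat_split_gram hs t⟩

lemma integral_Pset_eq (hs : ¬ HasSource I) (G : Matrix I I ℝ → ℝ) :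
    (∫ x : Coords I, if toMat I x ∈ Pset I then G (toMat I x) else 0) =
      ∫ t in posSet I, ((∏ i : I, 2 * t (Sum.inl i)) * ∏ i : I, t (Sum.inl i) ^ nup i) *
        G (tri t * (tri t)ᵀ) := by
  have himage : MeasurableSet (gram '' posSet I) :=
    measurableSet_posSet.image_of_continuousOn_injOn
      (fun t _ => (hasFDerivAt_gram t).continuousAt.continuousWithinAt) (injOn_gram hs)
  rw [← (volume_measurePreserving_sumPiEquivProdPi fun _ : Idx I => ℝ).integral_comp'
    (fun x => if toMat I x ∈ Pset I then G (toMat I x) else 0)]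
  have h1 : (fun x : Idx I → ℝ =>
      if toMat I (split x) ∈ Pset I then G (toMat I (split x)) else 0) =
      (gram '' posSet I).indicator fun x => G (toMat I (split x)) := by
    funext x
    rw [Set.indicator_apply]
    exact if_congr (toMat_split_mem_Pset_iff hs x) rfl rfl
  refine (congrArg (fun f => ∫ x, f x) h1).trans ?_
  rw [integral_indicator himage,
    integral_image_eq_integral_abs_det_fderiv_smul volume measurableSet_posSet
      (fun t _ => (hasFDerivAt_gram t).hasFDerivWithinAt) (injOn_gram hs)]
  refine setIntegral_congr_fun measurableSet_posSet fun t ht => ?_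
  have hdet : 0 < (∏ i : I, 2 * t (Sum.inl i)) * ∏ i : I, t (Sum.inl i) ^ nup i :=
    mul_pos (Finset.prod_pos fun i _ => mul_pos two_pos (ht i))
      (Finset.prod_pos fun i _ => pow_pos (ht i) _)
  simp only [det_gramDeriv, smul_eq_mul]
  rw [prod_strictPair_snd fun i => t (Sum.inl i), abs_of_pos hdet, toMat_split_gram hs]

lemma integral_comp_clm_of_det_pos (L : (Idx I → ℝ) →L[ℝ] (Idx I → ℝ)) (hL : 0 < L.det)
    (f : (Idx I → ℝ) → ℝ) : ∫ t, f (L t) = L.det⁻¹ * ∫ s, f s := by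
  have hbij : Function.Bijective L := by
    have h : IsUnit (L : (Idx I → ℝ) →ₗ[ℝ] (Idx I → ℝ)) :=
      (LinearMap.isUnit_iff_isUnit_det _).2 (isUnit_iff_ne_zero.2 hL.ne')
    exact (Module.End.isUnit_iff _).1 h
  have h := integral_image_eq_integral_abs_det_fderiv_smul volume MeasurableSet.univ
    (fun t _ => L.hasFDerivAt.hasFDerivWithinAt) hbij.injective.injOn f
  rw [Set.image_univ, hbij.surjective.range_eq, setIntegral_univ, setIntegral_univ,
    abs_of_pos hL] at h
  rw [h]
  simp only [smul_eq_mul]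
  rw [integral_const_mul, inv_mul_cancel_left₀ hL.ne']

/-! ### The one-dimensional integrals -/

/-- The factor of the Wishart integrand depending on a single coordinate of the
Cholesky factor. -/
noncomputable def factor (a : I → ℝ) : Idx I → ℝ → ℝ :=
  Sum.elim
    (fun i => (Set.Ioi 0).indicator fun x => 2 * (x ^ a i * Real.exp (-x ^ 2)))
    (fun _ x => Real.exp (-x ^ 2))

lemma integral_prod_factor {a : I → ℝ} (ha : ∀ i, -1 < a i) :
    ∫ s : Idx I → ℝ, ∏ p, factor a p (s p) =
      (∏ i, Real.Gamma ((a i + 1) / 2)) *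
        Real.pi ^ ((ntot I - (Fintype.card I : ℝ)) / 2) := by
  rw [integral_fintype_prod_volume_eq_prod, Fintype.prod_sum_type]
  congr 1
  · refine Finset.prod_congr rfl fun i _ => ?_
    simp only [factor, Sum.elim_inl]
    rw [integral_indicator measurableSet_Ioi, integral_const_mul]
    have h := integral_rpow_mul_exp_neg_rpow (p := 2) two_pos (ha i)
    simp only [Real.rpow_two] at h
    rw [h]
    ring
  · simp only [factor, Sum.elim_inr]
    have h := integral_gaussian 1
    simp only [neg_mul, one_mul, div_one] at h
    rw [h, Finset.prod_const, Finset.card_univ, ← card_strictPair, Real.sqrt_eq_rpow,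
      ← Real.rpow_natCast, ← Real.rpow_mul Real.pi_pos.le]
    congr 1
    ring

lemma integrand_eq_prod_factor {W : Matrix I I ℝ} (hW : IsTlPos I W) (lam : I → ℝ)
    {t : Idx I → ℝ} (ht : t ∈ posSet I) :
    ((∏ i : I, 2 * t (Sum.inl i)) * ∏ i : I, t (Sum.inl i) ^ nup i) *
        ((∏ i : I, (t (Sum.inl i) ^ 2) ^ (lam i - nmid i)) *
          Real.exp (-∑ p : Idx I, mulLeft W t p ^ 2)) =
      (∏ i : I, W i i ^ (-(2 * lam i - 1 - nlow i))) *
        ∏ p, factor (fun i => 2 * lam i - 1 - nlow i) p (mulLeft W t p) := by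
  have hdiag : ∀ i : I, factor (fun i => 2 * lam i - 1 - nlow i) (Sum.inl i)
      (mulLeft W t (Sum.inl i)) = 2 * (W i i * t (Sum.inl i)) ^ (2 * lam i - 1 - nlow i) *
        Real.exp (-mulLeft W t (Sum.inl i) ^ 2) := by
    intro i
    have hpos : mulLeft W t (Sum.inl i) ∈ Set.Ioi (0 : ℝ) := by
      rw [mulLeft_diag hW.1]
      exact mul_pos (hW.2 i) (ht i)
    rw [factor, Sum.elim_inl, Set.indicator_of_mem hpos, mulLeft_diag hW.1, mul_assoc]
  have hcoef : ∀ i : I, 2 * t (Sum.inl i) * t (Sum.inl i) ^ nup i *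
      (t (Sum.inl i) ^ 2) ^ (lam i - nmid i) =
      W i i ^ (-(2 * lam i - 1 - nlow i)) *
        (2 * (W i i * t (Sum.inl i)) ^ (2 * lam i - 1 - nlow i)) := by
    intro i
    have hti := ht i
    have hw := hW.2 i
    rw [Real.mul_rpow hw.le hti.le, Real.rpow_neg hw.le, mul_left_comm 2,
      inv_mul_cancel_left₀ (Real.rpow_pos_of_pos hw _).ne', mul_assoc 2, mul_assoc 2]
    congr 1
    rw [← pow_succ', ← Real.rpow_natCast, ← Real.rpow_natCast, ← Real.rpow_mul hti.le,
      ← Real.rpow_add hti]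
    congr 1
    rw [nmid]
    push_cast
    ring
  have hexp : Real.exp (-∑ p : Idx I, mulLeft W t p ^ 2) =
      (∏ i : I, Real.exp (-mulLeft W t (Sum.inl i) ^ 2)) *
        ∏ p : StrictPair I, Real.exp (-mulLeft W t (Sum.inr p) ^ 2) := by
    rw [← Finset.sum_neg_distrib, Real.exp_sum, Fintype.prod_sum_type]
  rw [Fintype.prod_sum_type, Finset.prod_congr rfl fun i _ => hdiag i, hexp]
  simp only [← mul_assoc]
  rw [← Finset.prod_mul_distrib, ← Finset.prod_mul_distrib, Finset.prod_congr rfl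
    fun i _ => hcoef i, Finset.prod_mul_distrib, Finset.prod_mul_distrib]
  simp only [mul_assoc, factor, Sum.elim_inr, Finset.prod_mul_distrib]

lemma prod_factor_eq_zero {W : Matrix I I ℝ} (hW : IsTlPos I W) (a : I → ℝ)
    {t : Idx I → ℝ} (ht : t ∉ posSet I) : ∏ p, factor a p (mulLeft W t p) = 0 := by
  simp only [posSet, Set.mem_ofPred_eq, not_forall, not_lt] at ht
  obtain ⟨i, hi⟩ := ht
  refine Finset.prod_eq_zero (Finset.mem_univ (Sum.inl i)) ?_
  rw [factor, Sum.elim_inl, Set.indicator_of_notMem]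
  rw [mulLeft_diag hW.1, Set.mem_Ioi, not_lt]
  exact mul_nonpos_of_nonneg_of_nonpos (hW.2 i).le hi

end PosetCholesky

/-- The normalization of the Wishart integral: for a finite poset `I` satisfying
condition (F) with no source, reals `λ_i > n_{i·}/2`, and `W ∈ 𝒯_l⁺`, with
`θ ∈ ℋ` the truncation of `Wᵀ·W` to comparable pairs,
`∫_𝒫 (∏_i X_{[i]·}^{λ_i−n_i}) exp(−tr(θX)) dX
  = π^{(n_{··}−|I|)/2} (∏_i Γ(λ_i−n_{i·}/2)) (∏_i W_{ii}^{−2λ_i})`,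
the integral being with respect to Lebesgue measure on `ℋ` in the coordinates
`(X_{ii})_i`, `(X_{ij})_{j≺i}`. -/
theorem wishart_normalization {I : Type*} [Fintype I] [DecidableEq I] [PartialOrder I]
    (hF : ConditionF I) (hs : ¬ HasSource I)
    (lam : I → ℝ) (hlam : ∀ i, (nlow i : ℝ) / 2 < lam i)
    (W : Matrix I I ℝ) (hW : IsTlPos I W)
    (θ : Matrix I I ℝ)
    (hθ : ∀ j k : I, θ j k = if j = k ∨ j ≤ k ∨ k ≤ j then (Wᵀ * W) j k else 0) :
    (∫ x : Coords I,
        if toMat I x ∈ Pset I then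
          (∏ i : I, bracket (toMat I x) i ^ (lam i - nmid i)) *
            Real.exp (-(θ * toMat I x).trace)
        else 0)
      = Real.pi ^ ((ntot I - (Fintype.card I : ℝ)) / 2) *
          (∏ i : I, Real.Gamma (lam i - (nlow i : ℝ) / 2)) *
          ∏ i : I, (W i i) ^ (-(2 * lam i)) := by
  open PosetCholesky in
  have hcongr : ∀ t ∈ posSet I,
      ((∏ i : I, 2 * t (Sum.inl i)) * ∏ i : I, t (Sum.inl i) ^ nup i) *
        ((∏ i : I, bracket (tri t * (tri t)ᵀ) i ^ (lam i - nmid i)) *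
          Real.exp (-(θ * (tri t * (tri t)ᵀ)).trace)) =
      (∏ i : I, W i i ^ (-(2 * lam i - 1 - nlow i))) *
        ∏ p, factor (fun i => 2 * lam i - 1 - nlow i) p (mulLeft W t p) := by
    intro t ht
    rw [← integrand_eq_prod_factor hW lam ht,
      trace_truncation_mul (mul_transpose_mem_Hset hs (isTl_tri t)) hθ,
      trace_gram_mul_gram hW.1 (isTl_tri t)]
    simp only [bracket_mul_transpose (isTlPos_tri ht), tri_diag, mulLeft_apply]
  have hdet : (PosetCholesky.mulLeft W).det = ∏ i : I, W i i ^ ((1 : ℝ) + nlow i) := by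
    rw [PosetCholesky.det_mulLeft hW.1, Fintype.prod_sum_type]
    simp only [PosetCholesky.row_inl, PosetCholesky.row_inr]
    rw [PosetCholesky.prod_strictPair_fst fun i => W i i, ← Finset.prod_mul_distrib]
    refine Finset.prod_congr rfl fun i _ => ?_
    rw [Real.rpow_add (hW.2 i), Real.rpow_one, Real.rpow_natCast]
  have hdet_pos : 0 < (PosetCholesky.mulLeft W).det := by
    rw [hdet]
    exact Finset.prod_pos fun i _ => Real.rpow_pos_of_pos (hW.2 i) _
  rw [PosetCholesky.integral_Pset_eq hs fun X =>
      (∏ i : I, bracket X i ^ (lam i - nmid i)) * Real.exp (-(θ * X).trace),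
    setIntegral_congr_fun PosetCholesky.measurableSet_posSet hcongr,
    setIntegral_eq_integral_of_forall_compl_eq_zero fun t ht => by
      rw [PosetCholesky.prod_factor_eq_zero hW _ ht, mul_zero],
    integral_const_mul,
    PosetCholesky.integral_comp_clm_of_det_pos _ hdet_pos fun s =>
      ∏ p, PosetCholesky.factor (fun i => 2 * lam i - 1 - nlow i) p (s p),
    PosetCholesky.integral_prod_factor fun i => by linarith [hlam i], hdet,
    ← Finset.prod_inv_distrib, ← mul_assoc, ← Finset.prod_mul_distrib, mul_comm,
    mul_comm (∏ i, Real.Gamma _), mul_assoc, mul_assoc]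
  congr 1
  congr 1
  · refine Finset.prod_congr rfl fun i _ => ?_
    congr 1
    ring
  · refine Finset.prod_congr rfl fun i _ => ?_
    rw [← Real.rpow_neg (hW.2 i).le, ← Real.rpow_add (hW.2 i)]
    congr 1
    ring
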